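/- Let φ ∈ OB. For every u ∈ H there exists a unique real p×p diagonal matrix Σ_{φ,u} solving ⟪φ, G_φ⁻¹(φΣ_{φ,u})⟫ = ⟪φ,u⟫, and the map P_φ(u) = u − G_φ⁻¹(φ Σ_{φ,u}) is the g_φ-orthogonal projection of H onto the tangent space T_φOB: P_φ maps H into T_φOB, P_φ ∘ P_φ = P_φ, and u − P_φ(u) ∈ (T_φOB)^⊥_{g_φ} for every u ∈ H. -/

import Mathlib

noncomputable section

/-- A coercive bilinear form is anisotropic. -/
theorem eq_zero_of_coercive_of_self_eq_zero {E : Type*} [NormedAddCommGroup E] [NormedSpace ℝ E]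
    {g : E →ₗ[ℝ] E →ₗ[ℝ] ℝ} (hg : ∃ c : ℝ, 0 < c ∧ ∀ u, c * ‖u‖ ^ 2 ≤ g u u)
    {x : E} (hx : g x x = 0) : x = 0 := by
  obtain ⟨c, hc, hcoer⟩ := hg
  have hsq : ‖x‖ ^ 2 = 0 :=
    le_antisymm (nonpos_of_mul_nonpos_right (hx ▸ hcoer x) hc) (sq_nonneg _)
  exact norm_eq_zero.mp (pow_eq_zero_iff two_ne_zero |>.mp hsq)

/-- Proposition 4.3, the `g_φ`-orthogonal projection onto the tangent
space. Abstract setting for the Gelfand triple `H ⊂ L ⊂ H*`: `H0` models `H¹₀(Ω)`,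
`H = Fin p → H0` models `[H¹₀(Ω)]^p`, `b` is the `L²`-pairing, `g` a symmetric bounded
coercive bilinear form with operator `G_φ`, and `Q w = G_φ⁻¹(w)` (the inverse applied to
elements of `L ⊂ H*`), i.e. `g(Q w, z) = Σ_j (w_j, z_j)_{L²}` for all `z`. Then for every
`u ∈ H` there is a unique diagonal `Σ_{φ,u}` with
`⟪φ, G_φ⁻¹(φΣ_{φ,u})⟫ = ⟪φ,u⟫`, and `P_φ(u) = u − G_φ⁻¹(φΣ_{φ,u})` maps into `T_φOB`,
is idempotent, and `u − P_φ(u)` lies in the `g_φ`-normal space. -/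
theorem tangent_projection
    {H0 : Type*} [NormedAddCommGroup H0] [InnerProductSpace ℝ H0] [CompleteSpace H0]
    {p : ℕ} (hp : 1 ≤ p)
    (b : H0 →ₗ[ℝ] H0 →ₗ[ℝ] ℝ)
    (hbsymm : ∀ u v, b u v = b v u)
    (hbpos : ∀ u, 0 ≤ b u u)
    (hbdef : ∀ u, b u u = 0 → u = 0)
    (hbcont : ∃ C : ℝ, ∀ u v, |b u v| ≤ C * ‖u‖ * ‖v‖)
    (N : Fin p → ℝ) (hN : ∀ j, 0 < N j)
    (g : (Fin p → H0) →ₗ[ℝ] (Fin p → H0) →ₗ[ℝ] ℝ)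
    (hgsymm : ∀ u v, g u v = g v u)
    (hgbdd : ∃ C : ℝ, ∀ u v, |g u v| ≤ C * ‖u‖ * ‖v‖)
    (hgcoer : ∃ c : ℝ, 0 < c ∧ ∀ u, c * ‖u‖ ^ 2 ≤ g u u)
    -- G_φ⁻¹ restricted to L ⊂ H*
    (Q : (Fin p → H0) → (Fin p → H0))
    (hQ : ∀ w z : Fin p → H0, g (Q w) z = ∑ j, b (w j) (z j))
    (φ : Fin p → H0) (hφ : ∀ j, b (φ j) (φ j) = N j) :
    -- unique solvability of ⟪φ, G_φ⁻¹(φΣ)⟫ = ⟪φ,u⟫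
    (∀ u : Fin p → H0, ∃! S : Fin p → ℝ,
        ∀ j, b (φ j) (Q (fun i => S i • φ i) j) = b (φ j) (u j)) ∧
    -- P_φ(u) = u − G_φ⁻¹(φΣ_{φ,u}) is the g_φ-orthogonal projection onto T_φOB
    (∀ P : (Fin p → H0) → (Fin p → H0),
      (∀ u, ∃ S : Fin p → ℝ,
          (∀ j, b (φ j) (Q (fun i => S i • φ i) j) = b (φ j) (u j)) ∧
          P u = u - Q fun i => S i • φ i) →
      -- maps into the tangent space
      (∀ u, ∀ j, b (φ j) (P u j) = 0) ∧
      -- idempotent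
      (∀ u, P (P u) = P u) ∧
      -- complement in the g_φ-normal space
      (∀ u, ∀ z : Fin p → H0, (∀ j, b (φ j) (z j) = 0) → g (u - P u) z = 0)) := by
  have ext_g {x y : Fin p → H0} (h : ∀ z, g x z = g y z) : x = y :=
    sub_eq_zero.mp <| eq_zero_of_coercive_of_self_eq_zero hgcoer <| by
      rw [LinearMap.map_sub₂, h, sub_self]
  let T : (Fin p → ℝ) →ₗ[ℝ] (Fin p → H0) :=
    { toFun := fun S => Q fun i => S i • φ i
      map_add' := fun S S' => ext_g fun z => by
        simp [hQ, add_mul, Finset.sum_add_distrib]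
      map_smul' := fun r S => ext_g fun z => by
        simp [hQ, mul_assoc, Finset.mul_sum] }
  have hT (S : Fin p → ℝ) : (Q fun i => S i • φ i) = T S := rfl
  have hgT (S : Fin p → ℝ) (z : Fin p → H0) : g (T S) z = ∑ j, S j * b (φ j) (z j) := by
    simp [← hT, hQ]
  let A : (Fin p → ℝ) →ₗ[ℝ] (Fin p → ℝ) :=
    LinearMap.pi fun j => b (φ j) ∘ₗ LinearMap.proj j ∘ₗ T
  have hA (S : Fin p → ℝ) (j : Fin p) : A S j = b (φ j) (T S j) := rfl
  have hA_ker (S : Fin p → ℝ) (hS : A S = 0) : S = 0 := by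
    have hTS : T S = 0 := eq_zero_of_coercive_of_self_eq_zero hgcoer <| by
      rw [hgT]
      exact Finset.sum_eq_zero fun j _ => by rw [← hA, hS, Pi.zero_apply, mul_zero]
    funext j
    have hj := hgT S (Pi.single j (φ j))
    rw [hTS, map_zero, LinearMap.zero_apply, Finset.sum_eq_single j
      (fun i _ hij => by simp [Pi.single_eq_of_ne hij]) (by simp), Pi.single_eq_same, hφ] at hj
    exact (mul_eq_zero.mp hj.symm).resolve_right (hN j).ne'
  have hA_inj : Function.Injective A := (injective_iff_map_eq_zero A).mpr hA_ker
  refine ⟨fun u => ?_, fun P hP => ?_⟩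
  · obtain ⟨S, hS⟩ := LinearMap.injective_iff_surjective.mp hA_inj fun j => b (φ j) (u j)
    exact ⟨S, congrFun hS, fun S' hS' => hA_inj ((funext hS').trans hS.symm)⟩
  · have hP_tangent (u : Fin p → H0) (j : Fin p) : b (φ j) (P u j) = 0 := by
      obtain ⟨S, hS, hPu⟩ := hP u
      rw [hPu, Pi.sub_apply, map_sub, hS, sub_self]
    refine ⟨hP_tangent, fun u => ?_, fun u z hz => ?_⟩
    · obtain ⟨S, hS, hPu⟩ := hP (P u)
      have hS0 : S = 0 := hA_ker S (funext fun j => (hS j).trans (hP_tangent u j))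
      rw [hPu, hT, hS0, map_zero, sub_zero]
    · obtain ⟨S, -, hPu⟩ := hP u
      rw [hPu, sub_sub_cancel, hT, hgT]
      exact Finset.sum_eq_zero fun j _ => by rw [hz, mul_zero]

end
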